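/- The graph T2 is not 3-colourable and is not word-representable. -/

import Mathlib

/-- Two distinct letters `x` and `y` alternate in the word `w` if, after deleting all
letters other than `x` and `y` from `w`, no two consecutive letters of the resulting
word are equal (i.e. it reads `xyxy...` or `yxyx...`). -/
def Alternates {V : Type*} [DecidableEq V] (w : List V) (x y : V) : Prop :=
  List.Chain' (· ≠ ·) (w.filter fun z => z = x ∨ z = y)

/-- A finite simple graph `G = (V, E)` is word-representable if there is a word over the
alphabet `V` in which every element of `V` occurs at least once and such that, for all
distinct `x, y ∈ V`, the letters `x` and `y` alternate in the word iff `{x, y} ∈ E`. -/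
def WordRepresentable {V : Type*} [DecidableEq V] (G : SimpleGraph V) : Prop :=
  ∃ w : List V, (∀ v : V, v ∈ w) ∧
    ∀ x y : V, x ≠ y → (G.Adj x y ↔ Alternates w x y)

/-- The simple graph on `V` whose edges are (the unordered versions of) the pairs
occurring in the list `l`. -/
def graphOfList {V : Type*} (l : List (V × V)) : SimpleGraph V :=
  SimpleGraph.fromRel fun a b => (a, b) ∈ l

def edgesT2 : List ((Fin 3 × Fin 3) × (Fin 3 × Fin 3)) :=
  [
    ((0, 0), (1, 0)), ((0, 0), (0, 1)), ((0, 1), (1, 1)), ((0, 1), (0, 2)), ((0, 2), (1, 2)),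
    ((1, 0), (2, 0)), ((1, 0), (1, 1)), ((1, 1), (2, 1)), ((1, 1), (1, 2)), ((1, 2), (2, 2)),
    ((2, 0), (2, 1)), ((2, 1), (2, 2)), ((0, 1), (1, 0)), ((0, 2), (1, 1)), ((1, 1), (2, 0)),
    ((1, 1), (2, 2))]

/-- The graph `T2` from the paper. -/
def graphT2 : SimpleGraph (Fin 3 × Fin 3) := graphOfList edgesT2

lemma chain_iff {V : Type*} [DecidableEq V] (w : List V) : ∀ (x y : V), x ≠ y →
    (List.IsChain (· ≠ ·) (y :: w.filter fun z => z = x ∨ z = y) ↔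
      ∀ p, (w.take p).count y ≤ (w.take p).count x ∧
        (w.take p).count x ≤ (w.take p).count y + 1) := by
  induction w with
  | nil => intro x y _; simp
  | cons a w ih =>
    intro x y hxy
    by_cases hx : a = x
    · subst hx
      have h := ih y a hxy.symm
      have e : (w.filter fun z => z = a ∨ z = y) = w.filter fun z => z = y ∨ z = a := by
        congr 1; funext z; simp [or_comm]
      rw [List.filter_cons_of_pos (by simp), List.isChain_cons_cons, e, h]
      constructor
      · rintro ⟨_, h⟩ p
        cases p with
        | zero => simp
        | succ p =>
          have := h p
          simp [List.take_succ_cons, List.count_cons, hxy]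
          omega
      · intro h
        refine ⟨hxy.symm, fun p => ?_⟩
        have := h (p+1)
        simp [List.take_succ_cons, List.count_cons, hxy] at this
        omega
    · by_cases hy : a = y
      · subst hy
        rw [List.filter_cons_of_pos (by simp), List.isChain_cons_cons]
        constructor
        · rintro ⟨h, _⟩; exact absurd rfl h
        · intro h
          have := h 1
          simp [List.count_cons, hx] at this
      · rw [List.filter_cons_of_neg (by simp [hx, hy]), ih x y hxy]
        constructor
        · intro h p
          cases p with
          | zero => simp
          | succ p => simpa [List.take_succ_cons, List.count_cons, hx, hy] using h p
        · intro h p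
          simpa [List.take_succ_cons, List.count_cons, hx, hy] using h (p+1)

lemma alt_iff {V : Type*} [DecidableEq V] (w : List V) (x y : V) (hxy : x ≠ y) :
    Alternates w x y ↔
      (∀ p, (w.take p).count y ≤ (w.take p).count x ∧
        (w.take p).count x ≤ (w.take p).count y + 1) ∨
      (∀ p, (w.take p).count x ≤ (w.take p).count y ∧
        (w.take p).count y ≤ (w.take p).count x + 1) := by
  have e : (w.filter fun z => z = y ∨ z = x) = w.filter fun z => z = x ∨ z = y := by
    congr 1; funext z; simp [or_comm]
  rw [← chain_iff w x y hxy, ← chain_iff w y x hxy.symm, e]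
  unfold Alternates
  change List.IsChain _ _ ↔ _
  cases h : w.filter fun z => z = x ∨ z = y with
  | nil => simp
  | cons a f =>
    simp only [List.isChain_cons_cons]
    constructor
    · intro hc
      by_cases hy : y = a
      · right; exact ⟨fun h => hxy (h.trans hy.symm), hc⟩
      · left; exact ⟨hy, hc⟩
    · rintro (⟨_, h⟩ | ⟨_, h⟩) <;> exact h

/-- The neighbourhood of a vertex is a comparability graph. -/
lemma nbhd_comparability {V : Type*} [DecidableEq V] (G : SimpleGraph V)
    (hG : WordRepresentable G) (c : V) :
    ∃ r : V → V → Prop, (∀ x y z, r x y → r y z → r x z) ∧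
      ∀ x y, x ≠ y → G.Adj c x → G.Adj c y → (G.Adj x y ↔ r x y ∨ r y x) := by
  obtain ⟨w, -, hw⟩ := hG
  have key : ∀ x, ∃ e : ℕ, G.Adj c x → e ≤ 1 ∧ ∀ p, (w.take p).count c ≤ (w.take p).count x + e ∧
      (w.take p).count x + e ≤ (w.take p).count c + 1 := by
    intro x
    by_cases h : G.Adj c x
    · have h2 := (hw c x h.ne).1 h
      rw [alt_iff w c x h.ne] at h2
      rcases h2 with h2 | h2
      · exact ⟨1, fun _ => ⟨le_rfl, fun p => by have := h2 p; omega⟩⟩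
      · exact ⟨0, fun _ => ⟨by omega, fun p => by have := h2 p; omega⟩⟩
    · exact ⟨0, fun h' => absurd h' h⟩
  choose e he using key
  refine ⟨fun x y => ∀ p, (w.take p).count y + e y ≤ (w.take p).count x + e x,
    fun x y z h1 h2 p => (h2 p).trans (h1 p), fun x y hxy hx hy => ?_⟩
  obtain ⟨ex, hx⟩ := he x hx
  obtain ⟨ey, hy⟩ := he y hy
  rw [hw x y hxy, alt_iff w x y hxy]
  constructor
  · rintro (h | h)
    · by_cases h0 : e y ≤ e x
      · left; intro p; have := h p; omega
      · right; intro p; have := h p; omega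
    · by_cases h0 : e x ≤ e y
      · right; intro p; have := h p; omega
      · left; intro p; have := h p; omega
  · rintro (h | h)
    · have h0 := h 0
      simp at h0
      by_cases h1 : e x = e y
      · left; intro p; have := h p; have := hx p; have := hy p; omega
      · right; intro p; have := h p; have := hx p; have := hy p; omega
    · have h0 := h 0
      simp at h0
      by_cases h1 : e x = e y
      · right; intro p; have := h p; have := hx p; have := hy p; omega
      · left; intro p; have := h p; have := hx p; have := hy p; omega

instance : DecidableRel graphT2.Adj := fun a b =>
  decidable_of_iff (a ≠ b ∧ ((a, b) ∈ edgesT2 ∨ (b, a) ∈ edgesT2)) (by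
    simp [graphT2, graphOfList, SimpleGraph.fromRel_adj])

/-- The 7-cycle around the centre. -/
def rim : Fin 7 → Fin 3 × Fin 3 :=
  ![(0, 1), (1, 0), (2, 0), (2, 1), (2, 2), (1, 2), (0, 2)]

lemma rim_center : ∀ i, graphT2.Adj (1, 1) (rim i) := by decide
lemma rim_next : ∀ i, graphT2.Adj (rim i) (rim (i + 1)) := by decide
lemma rim_next2 : ∀ i, ¬ graphT2.Adj (rim i) (rim (i + 2)) := by decide
lemma rim_ne2 : ∀ i, rim i ≠ rim (i + 2) := by decide

/-- The graph `T2` is not 3-colourable and is not word-representable. -/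
theorem graphT2_not_colorable_not_wordRepresentable :
    ¬ graphT2.Colorable 3 ∧ ¬ WordRepresentable graphT2 := by
  constructor
  · rintro ⟨C⟩
    have key : ∀ c a b d : Fin 3, c ≠ a → c ≠ b → c ≠ d → a ≠ b → b ≠ d → a = d := by decide
    have h : ∀ i, C (rim i) = C (rim (i + 2)) := fun i =>
      key (C (1, 1)) _ (C (rim (i + 1))) _ (C.valid (rim_center _)) (C.valid (rim_center _))
        (C.valid (rim_center _)) (C.valid (rim_next _))
        (by have := C.valid (rim_next (i + 1)); rwa [add_assoc] at this)
    exact C.valid (rim_next 6) ((h 0).trans ((h 2).trans (h 4))).symm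
  · intro hG
    obtain ⟨r, tr, hr⟩ := nbhd_comparability graphT2 hG (1, 1)
    have adj : ∀ i, r (rim i) (rim (i + 1)) ∨ r (rim (i + 1)) (rim i) := fun i =>
      (hr _ _ (rim_next i).ne (rim_center _) (rim_center _)).1 (rim_next i)
    have nadj : ∀ i, ¬ (r (rim i) (rim (i + 2)) ∨ r (rim (i + 2)) (rim i)) := fun i h =>
      rim_next2 i ((hr _ _ (rim_ne2 i) (rim_center _) (rim_center _)).2 h)
    have up : ∀ i, r (rim i) (rim (i + 1)) → ¬ r (rim (i + 1)) (rim (i + 2)) := fun i h h' =>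
      nadj i (Or.inl (tr _ _ _ h h'))
    have down : ∀ i, r (rim (i + 1)) (rim i) → ¬ r (rim (i + 2)) (rim (i + 1)) := fun i h h' =>
      nadj i (Or.inr (tr _ _ _ h' h))
    have step : ∀ i, r (rim i) (rim (i + 1)) ↔ ¬ r (rim (i + 1)) (rim (i + 1 + 1)) := by
      intro i
      have e : i + 1 + 1 = i + 2 := by rw [add_assoc]; rfl
      have a0 := adj i
      have a1 := adj (i + 1)
      have u := up i
      have d := down i
      rw [e] at a1 ⊢
      tauto
    have s0 := step 0
    have s1 := step 1
    have s2 := step 2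
    have s3 := step 3
    have s4 := step 4
    have s5 := step 5
    have s6 := step 6
    simp only [Fin.isValue, Fin.reduceAdd, zero_add] at s0 s1 s2 s3 s4 s5 s6
    tauto
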